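/- arXiv:1506.08169 — 3 statements merged into one kernel-verified Lean document; each statement's English description precedes it below -/
import Mathlib

section
/- Let n be a positive integer, F the finite field of order 2^n with n ≥ 2, and let G be the semidirect product of the additive group of F by the multiplicative group F^× acting by field multiplication. Then G has exactly two Q_2-valued irreducible characters. -/
open scoped Classical

noncomputable section

/-- `Qfield p` is the subfield of `ℂ` obtained by adjoining to `ℚ` all `p^a`-th
roots of unity for all positive integers `a` (any subfield of `ℂ` contains `ℚ`). -/
def Qfield (p : ℕ) : Subfield ℂ :=
  Subfield.closure {x : ℂ | ∃ a : ℕ, 0 < a ∧ x ^ p ^ a = 1}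

/-- `χ : G → ℂ` is an irreducible (ordinary, complex) character of `G` if it is the
character of some simple finite-dimensional complex representation of `G`. -/
def IsIrreducibleCharacter (G : Type) [Group G] (χ : G → ℂ) : Prop :=
  ∃ V : FDRep ℂ G, CategoryTheory.Simple V ∧ χ = fun g => V.character g

/-- The set of `Q_p`-valued irreducible characters of `G`. -/
def QpValuedIrrChars (p : ℕ) (G : Type) [Group G] : Set (G → ℂ) :=
  {χ | IsIrreducibleCharacter G χ ∧ ∀ g, χ g ∈ Qfield p}

theorem exists_mem_adjoin_of_mem_Qfield {p : ℕ} {z : ℂ} (hz : z ∈ Qfield p) :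
    ∃ a : ℕ, z ∈ IntermediateField.adjoin ℚ {x : ℂ | x ^ p ^ a = 1} := by
  have mono {a b : ℕ} (h : a ≤ b) : IntermediateField.adjoin ℚ {x : ℂ | x ^ p ^ a = 1} ≤
      IntermediateField.adjoin ℚ {x : ℂ | x ^ p ^ b = 1} := by
    refine IntermediateField.adjoin.mono ℚ _ _ fun x hx => ?_
    obtain ⟨c, rfl⟩ := Nat.exists_eq_add_of_le h
    have hx : x ^ p ^ a = 1 := hx
    change x ^ p ^ (a + c) = 1
    rw [pow_add, pow_mul, hx, one_pow]
  induction hz using Subfield.closure_induction with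
  | mem x hx =>
    obtain ⟨a, -, ha⟩ := hx
    exact ⟨a, IntermediateField.subset_adjoin _ _ ha⟩
  | one => exact ⟨0, one_mem _⟩
  | add x y _ _ hx hy =>
    obtain ⟨a, ha⟩ := hx
    obtain ⟨b, hb⟩ := hy
    exact ⟨max a b, add_mem (mono (le_max_left a b) ha) (mono (le_max_right a b) hb)⟩
  | neg x _ hx =>
    obtain ⟨a, ha⟩ := hx
    exact ⟨a, neg_mem ha⟩
  | inv x _ hx =>
    obtain ⟨a, ha⟩ := hx
    exact ⟨a, inv_mem ha⟩
  | mul x y _ _ hx hy =>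
    obtain ⟨a, ha⟩ := hx
    obtain ⟨b, hb⟩ := hy
    exact ⟨max a b, mul_mem (mono (le_max_left a b) ha) (mono (le_max_right a b) hb)⟩

/-- The only root of unity of odd order in `Qfield 2` is `1`. -/
theorem eq_one_of_mem_Qfield_two {z : ℂ} (hz : z ∈ Qfield 2) {m : ℕ} (hm : Odd m)
    (hzm : z ^ m = 1) : z = 1 := by
  obtain ⟨a, ha⟩ := exists_mem_adjoin_of_mem_Qfield hz
  have hζ := Complex.isPrimitiveRoot_exp (2 ^ a) (by positivity)
  set ζ := Complex.exp (2 * Real.pi * Complex.I / ((2 ^ a : ℕ) : ℂ))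
  have hle : IntermediateField.adjoin ℚ {x : ℂ | x ^ 2 ^ a = 1} ≤
      IntermediateField.adjoin ℚ {ζ} := by
    refine IntermediateField.adjoin_le_iff.2 fun x hx => ?_
    obtain ⟨i, -, rfl⟩ := hζ.eq_pow_of_pow_eq_one hx
    exact pow_mem (IntermediateField.mem_adjoin_simple_self ℚ ζ) i
  have : IsCyclotomicExtension {2 ^ a} ℚ (IntermediateField.adjoin ℚ {ζ}) :=
    (IntermediateField.isCyclotomicExtension_singleton_iff_eq_adjoin _ _ _ _ hζ).2 rfl
  have : NumberField (IntermediateField.adjoin ℚ {ζ}) :=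
    IsCyclotomicExtension.numberField {2 ^ a} ℚ _
  let w : IntermediateField.adjoin ℚ {ζ} := ⟨z, hle ha⟩
  have hwm : w ^ m = 1 := Subtype.ext hzm
  have hord : orderOf w ∣ m := orderOf_dvd_of_pow_eq_one hwm
  have hdvd : orderOf w ∣ 2 * 2 ^ a :=
    (IsPrimitiveRoot.orderOf w).dvd_of_isCyclotomicExtension _
      (ne_zero_of_dvd_ne_zero hm.pos.ne' hord)
  rw [← pow_succ'] at hdvd
  have hcop : Nat.Coprime m (2 ^ (a + 1)) := (Nat.coprime_two_right.2 hm).pow_right _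
  have h1 : orderOf w = 1 := Nat.eq_one_of_dvd_coprimes hcop hord hdvd
  exact congrArg Subtype.val (orderOf_eq_one_iff.1 h1)

section Schur

variable {G : Type} [Group G]

/-- Schur's lemma for a single operator commuting with a simple representation. -/
theorem FDRep.exists_eq_smul_id_of_commute (V : FDRep ℂ G) [CategoryTheory.Simple V]
    (f : V →ₗ[ℂ] V) (hf : ∀ g, f ∘ₗ V.ρ g = V.ρ g ∘ₗ f) :
    ∃ c : ℂ, f = c • LinearMap.id := by
  have h1 : Module.finrank ℂ (Representation.invariants (Representation.linHom V.ρ V.ρ)) = 1 := by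
    rw [(Representation.linHom.invariantsEquivFDRepHom V V).finrank_eq]
    exact CategoryTheory.finrank_endomorphism_simple_eq_one ℂ V
  have mem (f : V →ₗ[ℂ] V) (hf : ∀ g, f ∘ₗ V.ρ g = V.ρ g ∘ₗ f) :
      f ∈ Representation.invariants (Representation.linHom V.ρ V.ρ) := by
    intro g
    ext x
    have h := LinearMap.congr_fun (hf g) (V.ρ g⁻¹ x)
    simp only [LinearMap.comp_apply, Representation.linHom_apply,
      Representation.self_inv_apply] at h ⊢
    exact h.symm
  have hid := mem LinearMap.id fun g => rfl
  have hne : (⟨LinearMap.id, hid⟩ :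
      Representation.invariants (Representation.linHom V.ρ V.ρ)) ≠ 0 := by
    intro h0
    have h0' : (LinearMap.id : V →ₗ[ℂ] V) = 0 := congrArg Subtype.val h0
    have hall (f : Representation.invariants (Representation.linHom V.ρ V.ρ)) : f = 0 := by
      refine Subtype.ext (LinearMap.ext fun x => ?_)
      have hx : x = 0 := by simpa using LinearMap.congr_fun h0' x
      simp [hx]
    have : Subsingleton (Representation.invariants (Representation.linHom V.ρ V.ρ)) :=
      ⟨fun a b => (hall a).trans (hall b).symm⟩
    simp [Module.finrank_zero_of_subsingleton] at h1
  obtain ⟨c, hc⟩ := (finrank_eq_one_iff_of_nonzero' _ hne).1 h1 ⟨f, mem f hf⟩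
  exact ⟨c, (congrArg Subtype.val hc).symm⟩

/-- A simple representation of a finite group whose operators commute has dimension one, and each
operator is multiplication by the value of the character. -/
theorem FDRep.finrank_eq_one_and_eq_character_smul_id_of_commute [Finite G] (V : FDRep ℂ G)
    [CategoryTheory.Simple V] (hcomm : ∀ g h, V.ρ g ∘ₗ V.ρ h = V.ρ h ∘ₗ V.ρ g) :
    (Module.finrank ℂ V : ℂ) = 1 ∧ ∀ g, V.ρ g = V.character g • LinearMap.id := by
  have := Fintype.ofFinite G
  choose c hc using fun g => FDRep.exists_eq_smul_id_of_commute V (V.ρ g) (hcomm g)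
  have hχ (g : G) : V.character g = c g * Module.finrank ℂ V := by
    rw [FDRep.character, hc g, map_smul, LinearMap.trace_id, smul_eq_mul]
  have hd0 : (Module.finrank ℂ V : ℂ) ≠ 0 := by
    intro h0
    have hn := (FDRep.simple_iff_char_is_norm_one V).1 inferInstance
    simp [hχ, h0] at hn
    exact Fintype.card_ne_zero (Nat.cast_eq_zero.1 hn.symm)
  have hcc (g : G) : c g * c g⁻¹ = 1 := by
    have h := congrArg (LinearMap.trace ℂ V) (map_mul V.ρ g g⁻¹)
    rw [mul_inv_cancel, map_one, hc g, hc g⁻¹] at h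
    simp only [smul_mul_smul_comm, map_smul, smul_eq_mul] at h
    change LinearMap.trace ℂ V 1 = _ * LinearMap.trace ℂ V (1 * 1) at h
    rw [mul_one, LinearMap.trace_one] at h
    exact (mul_right_cancel₀ hd0 ((one_mul _).trans h)).symm
  have hd : (Module.finrank ℂ V : ℂ) = 1 := by
    have hn := (FDRep.simple_iff_char_is_norm_one V).1 inferInstance
    have hterm (g : G) : V.character g * V.character g⁻¹ = (Module.finrank ℂ V : ℂ) ^ 2 := by
      rw [hχ, hχ]
      linear_combination (Module.finrank ℂ V : ℂ) ^ 2 * hcc g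
    simp only [hterm, Finset.sum_const, Finset.card_univ, nsmul_eq_mul,
      Nat.card_eq_fintype_card] at hn
    have hG : (Fintype.card G : ℂ) ≠ 0 := by simp
    have h2 : (Module.finrank ℂ V : ℂ) ^ 2 = 1 := mul_left_cancel₀ hG (by rw [hn, mul_one])
    have h3 : Module.finrank ℂ V ^ 2 = 1 := by exact_mod_cast h2
    exact_mod_cast (Nat.pow_eq_one.1 h3).resolve_right two_ne_zero
  refine ⟨hd, fun g => ?_⟩
  rw [hχ, hd, mul_one]
  exact hc g

end Schur

/-- The irreducible character of degree `|F| - 1` of `F⁺ ⋊ Fˣ`. -/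
def affineChar {F : Type} [Field F] [Fintype F] {φ : Fˣ →* MulAut (Multiplicative F)}
    (g : Multiplicative F ⋊[φ] Fˣ) : ℂ :=
  if g.right = 1 then (if g.left = 1 then (Fintype.card F : ℂ) else 0) - 1 else 0

section Affine

variable {F : Type} [Field F] [Fintype F] {φ : Fˣ →* MulAut (Multiplicative F)}

instance : Finite (Multiplicative F ⋊[φ] Fˣ) := Finite.of_equiv _ SemidirectProduct.equivProd.symm

/-- The monomial representation of `F⁺ ⋊ Fˣ` induced from an additive character of `F`. -/
def affineRep (hφ : ∀ (u : Fˣ) (x : F),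
      φ u (Multiplicative.ofAdd x) = Multiplicative.ofAdd ((u : F) * x)) (ψ : AddChar F ℂ) :
    Representation ℂ (Multiplicative F ⋊[φ] Fˣ) (Fˣ → ℂ) where
  toFun g :=
    { toFun f w := ψ (w * g.left.toAdd) * f (w * g.right)
      map_add' f₁ f₂ := by
        ext w
        simp [mul_add]
      map_smul' c f := by
        ext w
        simp [mul_left_comm] }
  map_one' := by
    ext f w
    simp
  map_mul' g h := by
    refine LinearMap.ext fun f => funext fun w => ?_
    have hl : (g * h).left.toAdd = g.left.toAdd + g.right * h.left.toAdd := by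
      have := hφ g.right h.left.toAdd
      rw [ofAdd_toAdd] at this
      simp [this]
    simp only [LinearMap.coe_mk, AddHom.coe_mk, Module.End.mul_apply, hl,
      SemidirectProduct.mul_right, mul_add, AddChar.map_add_eq_mul, Units.val_mul,
      mul_assoc]

theorem affineRep_character (hφ : ∀ (u : Fˣ) (x : F),
      φ u (Multiplicative.ofAdd x) = Multiplicative.ofAdd ((u : F) * x))
    {ψ : AddChar F ℂ} (hψ : ψ.IsPrimitive) (g : Multiplicative F ⋊[φ] Fˣ) :
    LinearMap.trace ℂ (Fˣ → ℂ) (affineRep hφ ψ g) = affineChar g := by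
  rw [LinearMap.trace_eq_matrix_trace ℂ (Pi.basisFun ℂ Fˣ), Matrix.trace]
  have hdiag (w : Fˣ) : (LinearMap.toMatrix (Pi.basisFun ℂ Fˣ) (Pi.basisFun ℂ Fˣ)
      (affineRep hφ ψ g)).diag w = ψ (w * g.left.toAdd) * if g.right = 1 then 1 else 0 := by
    simp [affineRep, Pi.single_apply]
  simp only [hdiag, affineChar]
  split_ifs with h1 h2
  · simp [h2, Fintype.card_units, Nat.cast_sub (Fintype.card_pos (α := F))]
  · have hsum := AddChar.sum_mulShift g.left.toAdd hψ
    rw [if_neg (by simpa using h2), Fintype.sum_eq_add_sum_subtype_ne _ (0 : F)] at hsum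
    simp only [zero_mul, AddChar.map_zero_eq_one, Nat.cast_zero] at hsum
    rw [← unitsEquivNeZero.sum_comp] at hsum
    simp only [mul_one]
    rw [zero_sub, eq_neg_iff_add_eq_zero, add_comm]
    exact hsum
  · simp

theorem sum_semidirectProduct [Fintype (Multiplicative F ⋊[φ] Fˣ)]
    (f : Multiplicative F ⋊[φ] Fˣ → ℂ) :
    ∑ g, f g = ∑ v : F, ∑ u : Fˣ, f ⟨Multiplicative.ofAdd v, u⟩ := by
  rw [← SemidirectProduct.equivProd.symm.sum_comp, Fintype.sum_prod_type,
    ← Multiplicative.ofAdd.sum_comp]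
  rfl

theorem sum_mul_affineChar [Fintype (Multiplicative F ⋊[φ] Fˣ)]
    (f : Multiplicative F ⋊[φ] Fˣ → ℂ) :
    ∑ g, f g * affineChar g⁻¹ =
      Fintype.card F * f 1 - ∑ v : Multiplicative F, f (SemidirectProduct.inl v) := by
  have hterm (v : F) : ∑ u : Fˣ, f ⟨Multiplicative.ofAdd v, u⟩ *
      affineChar (⟨Multiplicative.ofAdd v, u⟩ : Multiplicative F ⋊[φ] Fˣ)⁻¹ =
      f (SemidirectProduct.inl (Multiplicative.ofAdd v)) *
        ((if v = 0 then (Fintype.card F : ℂ) else 0) - 1) := by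
    rw [Finset.sum_eq_single 1]
    · simp [affineChar]
    · intro u _ hu
      rw [affineChar, if_neg (by simpa using hu), mul_zero]
    · simp
  rw [sum_semidirectProduct]
  simp only [hterm, mul_sub, Finset.sum_sub_distrib, mul_ite, mul_zero, mul_one]
  rw [← Multiplicative.ofAdd.sum_comp]
  simp [mul_comm]

theorem isIrreducibleCharacter_affineChar (hφ : ∀ (u : Fˣ) (x : F),
      φ u (Multiplicative.ofAdd x) = Multiplicative.ofAdd ((u : F) * x)) :
    IsIrreducibleCharacter (Multiplicative F ⋊[φ] Fˣ) affineChar := by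
  have := Fintype.ofFinite (Multiplicative F ⋊[φ] Fˣ)
  have hψ := AddChar.FiniteField.primitiveChar_to_Complex_isPrimitive F
  have hχ (g) : (FDRep.of (affineRep hφ _)).character g = affineChar g :=
    affineRep_character hφ hψ g
  refine ⟨FDRep.of (affineRep hφ _), ?_, funext fun g => (hχ g).symm⟩
  rw [FDRep.simple_iff_char_is_norm_one]
  simp only [hχ]
  rw [sum_mul_affineChar, SemidirectProduct.card]
  have hone : affineChar (1 : Multiplicative F ⋊[φ] Fˣ) = Fintype.card F - 1 := by
    simp [affineChar]
  have hinl (v : Multiplicative F) :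
      affineChar (SemidirectProduct.inl v : Multiplicative F ⋊[φ] Fˣ) =
        (if v = 1 then (Fintype.card F : ℂ) else 0) - 1 := by
    by_cases hv : v = 1 <;> simp [affineChar, hv]
  simp only [hone, hinl, Finset.sum_sub_distrib]
  rw [Fintype.sum_eq_single 1 fun x hx => if_neg hx]
  simp [Fintype.card_units, Nat.cast_sub (Fintype.card_pos (α := F))]

theorem isIrreducibleCharacter_one (G : Type) [Group G] [Finite G] :
    IsIrreducibleCharacter G 1 := by
  have := Fintype.ofFinite G
  have hχ (g) : (FDRep.of (Representation.trivial ℂ G ℂ)).character g = 1 := by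
    simp [FDRep.character]
  refine ⟨FDRep.of (Representation.trivial ℂ G ℂ), ?_, funext fun g => (hχ g).symm⟩
  rw [FDRep.simple_iff_char_is_norm_one]
  simp [hχ]

/-- A simple representation of `F⁺ ⋊ Fˣ` either has character `affineChar` or is trivial on
`F⁺`. -/
theorem character_eq_affineChar_or (hφ : ∀ (u : Fˣ) (x : F),
      φ u (Multiplicative.ofAdd x) = Multiplicative.ofAdd ((u : F) * x))
    (V : FDRep ℂ (Multiplicative F ⋊[φ] Fˣ)) [CategoryTheory.Simple V] :
    (V.character = affineChar) ∨ ∀ v, V.ρ (SemidirectProduct.inl v) = 1 := by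
  have := Fintype.ofFinite (Multiplicative F ⋊[φ] Fˣ)
  have := invertibleOfNonzero (NeZero.ne (Nat.card (Multiplicative F ⋊[φ] Fˣ) : ℂ))
  have := invertibleOfNonzero (NeZero.ne (Nat.card (Multiplicative F) : ℂ))
  obtain ⟨W, hW, hWχ⟩ := isIrreducibleCharacter_affineChar hφ
  have horth := FDRep.char_orthonormal V W
  by_cases hiso : Nonempty (V ≅ W)
  · exact Or.inl ((FDRep.char_iso hiso.some).trans hWχ.symm)
  right
  have hWg (g) : W.character g = affineChar g := (congrFun hWχ g).symm
  simp only [hWg] at horth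
  rw [if_neg hiso, sum_mul_affineChar, mul_eq_zero, or_iff_right (by simp), FDRep.char_one,
    sub_eq_zero] at horth
  let σ : Representation ℂ (Multiplicative F) V := V.ρ.comp SemidirectProduct.inl
  have hfin := Representation.card_inv_mul_sum_char_eq_finrank σ
  have hq : (Fintype.card F : ℂ) ≠ 0 := by simp
  have hσ : ∑ v, σ.character v = Fintype.card F * (Module.finrank ℂ V : ℂ) := horth.symm
  have hcard : Nat.card (Multiplicative F) = Fintype.card F := by simp
  rw [hσ, hcard, inv_mul_cancel_left₀ hq, Nat.cast_inj] at hfin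
  have htop := Submodule.eq_top_of_finrank_eq hfin.symm
  intro v
  ext x
  have hx : x ∈ σ.invariants := htop ▸ Submodule.mem_top
  exact hx v

end Affine

/-- Let `F` be the finite field with `2 ^ n` elements, `n ≥ 2`, and `G = F⁺ ⋊ Fˣ`
the semidirect product of the additive group of `F` (written multiplicatively) by
`Fˣ` acting by field multiplication.  Then `G` has exactly two `Q_2`-valued
irreducible characters. -/
theorem two_Q2_valued_irr_chars (n : ℕ) (hn : 2 ≤ n)
    (F : Type) [Field F] [Fintype F] (hF : Fintype.card F = 2 ^ n)
    (φ : Fˣ →* MulAut (Multiplicative F))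
    (hφ : ∀ (u : Fˣ) (x : F),
      φ u (Multiplicative.ofAdd x) = Multiplicative.ofAdd ((u : F) * x)) :
    (QpValuedIrrChars 2 (Multiplicative F ⋊[φ] Fˣ)).ncard = 2 := by
  have hq : (4 : ℕ) ≤ Fintype.card F := hF ▸ Nat.pow_le_pow_right two_pos hn
  have hne : (1 : Multiplicative F ⋊[φ] Fˣ → ℂ) ≠ affineChar := by
    intro h
    have h1 := congrFun h 1
    simp only [Pi.one_apply, affineChar, SemidirectProduct.one_right, SemidirectProduct.one_left,
      if_true] at h1
    have h2 : (Fintype.card F : ℂ) = (2 : ℕ) := by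
      push_cast
      linear_combination -h1
    have := Nat.cast_injective h2
    omega
  suffices h : QpValuedIrrChars 2 (Multiplicative F ⋊[φ] Fˣ) = {1, affineChar} by
    rw [h, Set.ncard_pair hne]
  ext χ
  rw [Set.mem_insert_iff, Set.mem_singleton_iff]
  constructor
  · rintro ⟨⟨V, hV, rfl⟩, hval⟩
    rcases character_eq_affineChar_or hφ V with h | h
    · exact Or.inr h
    left
    have hρ (g : Multiplicative F ⋊[φ] Fˣ) : V.ρ g = V.ρ (SemidirectProduct.inr g.right) := by
      conv_lhs => rw [← SemidirectProduct.inl_left_mul_inr_right g, map_mul, h, one_mul]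
    obtain ⟨hfin, hscalar⟩ := FDRep.finrank_eq_one_and_eq_character_smul_id_of_commute V fun g g' => by
      change V.ρ g * V.ρ g' = V.ρ g' * V.ρ g
      rw [hρ g, hρ g', ← map_mul, ← map_mul, ← map_mul, ← map_mul, mul_comm]
    funext g
    refine eq_one_of_mem_Qfield_two (hval g) (m := Fintype.card F - 1) ?_ ?_
    · rw [hF]
      exact Nat.Even.sub_odd Nat.one_le_two_pow ((Nat.even_pow.2 ⟨even_two, by omega⟩)) odd_one
    · have hpow : V.ρ g ^ (Fintype.card F - 1) = 1 := by
        rw [hρ g, ← map_pow, ← map_pow, ← Fintype.card_units, pow_card_eq_one, map_one, map_one]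
      rw [hscalar g, smul_pow] at hpow
      have htr := congrArg (LinearMap.trace ℂ V) hpow
      change LinearMap.trace ℂ V (_ • (1 : V →ₗ[ℂ] V) ^ _) = _ at htr
      rw [one_pow, map_smul, LinearMap.trace_one, hfin] at htr
      simpa using htr
  · rintro (rfl | rfl)
    · exact ⟨isIrreducibleCharacter_one _, fun g => one_mem _⟩
    · refine ⟨isIrreducibleCharacter_affineChar hφ, fun g => ?_⟩
      unfold affineChar
      split_ifs
      · exact sub_mem (natCast_mem _ _) (one_mem _)
      · exact sub_mem (zero_mem _) (one_mem _)
      · exact zero_mem _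
end
end

section
/- Let p be an odd prime, n a positive integer, F the finite field of order p^n, and let G be the semidirect product of the additive group of F by the multiplicative group F^× acting by field multiplication. Then G has exactly three Q_p-valued irreducible characters. -/
open scoped Classical

noncomputable section

namespace IsIrreducibleCharacter

variable {G : Type} [Group G] {χ χ' : G → ℂ}

lemma apply_one (h : IsIrreducibleCharacter G χ) : ∃ d : ℕ, χ 1 = d := by
  obtain ⟨V, -, rfl⟩ := h
  exact ⟨_, V.char_one⟩

lemma apply_conj (h : IsIrreducibleCharacter G χ) (g t : G) : χ (t * g * t⁻¹) = χ g := by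
  obtain ⟨V, -, rfl⟩ := h
  exact V.char_conj g t

variable [Fintype G]

lemma sum_mul_inv (h : IsIrreducibleCharacter G χ) :
    ∑ g, χ g * χ g⁻¹ = Nat.card G := by
  obtain ⟨V, hV, rfl⟩ := h
  exact V.simple_iff_char_is_norm_one.1 hV

lemma sum_mul_inv_eq_zero (h : IsIrreducibleCharacter G χ) (h' : IsIrreducibleCharacter G χ')
    (hne : χ ≠ χ') : ∑ g, χ g * χ' g⁻¹ = 0 := by
  obtain ⟨V, hV, rfl⟩ := h
  obtain ⟨W, hW, rfl⟩ := h'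
  have := invertibleOfNonzero (NeZero.ne (Nat.card G : ℂ))
  have key := FDRep.char_orthonormal V W
  rw [if_neg (fun ⟨i⟩ => hne (FDRep.char_iso i))] at key
  simpa using key

lemma of_sum_mul_inv {V : Type} [AddCommGroup V] [Module ℂ V] [FiniteDimensional ℂ V]
    (ρ : Representation ℂ G V) (hρ : ∀ g, LinearMap.trace ℂ V (ρ g) = χ g)
    (h : ∑ g, χ g * χ g⁻¹ = Nat.card G) : IsIrreducibleCharacter G χ := by
  have hχ : χ = fun g => (FDRep.of ρ).character g := funext fun g => (hρ g).symm
  refine ⟨FDRep.of ρ, ?_, hχ⟩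
  rw [FDRep.simple_iff_char_is_norm_one, ← h, hχ]

end IsIrreducibleCharacter

lemma IsIrreducibleCharacter.of_monoidHom {G : Type} [Group G] [Finite G] (l : G →* ℂ) :
    IsIrreducibleCharacter G l := by
  have := Fintype.ofFinite G
  refine of_sum_mul_inv ((Algebra.lmul ℂ ℂ).toMonoidHom.comp l) (fun g => ?_) ?_
  · exact Algebra.trace_self_apply (l g)
  · rw [Finset.sum_congr rfl fun g _ => (map_mul l g g⁻¹).symm]
    simp

section RootsOfUnity

open IntermediateField

lemma mem_adjoin_of_mem_Qfield {p : ℕ} (hp : p.Prime) {x : ℂ} (hx : x ∈ Qfield p) :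
    ∃ a : ℕ, ∃ ζ : ℂ, IsPrimitiveRoot ζ (p ^ a) ∧ x ∈ ℚ⟮ζ⟯ := by
  have hprim (a : ℕ) := Complex.isPrimitiveRoot_exp (p ^ a) (pow_pos hp.pos a).ne'
  set z : ℕ → ℂ := fun a => Complex.exp (2 * Real.pi * Complex.I / (p ^ a : ℕ))
  have hmem (a : ℕ) (y : ℂ) (hy : y ^ p ^ a = 1) : y ∈ ℚ⟮z a⟯ := by
    have : NeZero (p ^ a) := ⟨(pow_pos hp.pos a).ne'⟩
    obtain ⟨i, -, rfl⟩ := (hprim a).eq_pow_of_pow_eq_one hy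
    exact pow_mem (mem_adjoin_simple_self ℚ _) i
  have hmono {a b : ℕ} (hab : a ≤ b) : ℚ⟮z a⟯ ≤ ℚ⟮z b⟯ := by
    rw [adjoin_simple_le_iff]
    refine hmem b _ ?_
    obtain ⟨c, rfl⟩ := Nat.exists_eq_add_of_le hab
    rw [pow_add, pow_mul, (hprim a).pow_eq_one, one_pow]
  suffices h : ∃ a, x ∈ ℚ⟮z a⟯ by
    obtain ⟨a, ha⟩ := h
    exact ⟨a, z a, hprim a, ha⟩
  have htwo {x y : ℂ} (hx : ∃ a, x ∈ ℚ⟮z a⟯) (hy : ∃ a, y ∈ ℚ⟮z a⟯) :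
      ∃ a, x ∈ ℚ⟮z a⟯ ∧ y ∈ ℚ⟮z a⟯ := by
    obtain ⟨a, ha⟩ := hx
    obtain ⟨b, hb⟩ := hy
    exact ⟨max a b, hmono (le_max_left a b) ha, hmono (le_max_right a b) hb⟩
  induction hx using Subfield.closure_induction with
  | mem x hx => exact ⟨hx.choose, hmem _ _ hx.choose_spec.2⟩
  | one => exact ⟨0, one_mem _⟩
  | add x y _ _ hx hy => exact (htwo hx hy).imp fun _ h => add_mem h.1 h.2
  | neg x _ hx => exact hx.imp fun _ h => neg_mem h
  | inv x _ hx => exact hx.imp fun _ h => inv_mem h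
  | mul x y _ _ hx hy => exact (htwo hx hy).imp fun _ h => mul_mem h.1 h.2

lemma eq_one_or_eq_neg_one_of_mem_Qfield {p m : ℕ} (hp : p.Prime) (hodd : Odd p)
    (hm : 0 < m) (hpm : p.Coprime m) {x : ℂ} (hx : x ∈ Qfield p) (hxm : x ^ m = 1) :
    x = 1 ∨ x = -1 := by
  obtain ⟨a, ζ, hζ, hxζ⟩ := mem_adjoin_of_mem_Qfield hp hx
  have : NeZero (p ^ a) := ⟨(pow_pos hp.pos a).ne'⟩
  have : IsCyclotomicExtension {p ^ a} ℚ ℚ⟮ζ⟯ := by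
    change IsCyclotomicExtension {p ^ a} ℚ ℚ⟮ζ⟯.toSubalgebra
    rw [adjoin_simple_toSubalgebra_of_isAlgebraic
      (hζ.isIntegral (pow_pos hp.pos a)).tower_top.isAlgebraic]
    exact hζ.adjoin_isCyclotomicExtension ℚ
  have : NumberField ℚ⟮ζ⟯ := IsCyclotomicExtension.numberField {p ^ a} ℚ ℚ⟮ζ⟯
  have hζ' : IsPrimitiveRoot (AdjoinSimple.gen ℚ ζ) (p ^ a) :=
    IsPrimitiveRoot.of_map_of_injective (f := algebraMap ℚ⟮ζ⟯ ℂ) (by simpa using hζ)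
      (algebraMap ℚ⟮ζ⟯ ℂ).injective
  have hfin : IsOfFinOrder (⟨x, hxζ⟩ : ℚ⟮ζ⟯) :=
    isOfFinOrder_iff_pow_eq_one.2 ⟨m, hm, Subtype.ext hxm⟩
  obtain ⟨r, hr⟩ := hζ'.exists_neg_pow_of_isOfFinOrder hodd.pow hfin
  have hr : x = (-ζ) ^ r := by simpa using congrArg (algebraMap ℚ⟮ζ⟯ ℂ) hr
  have h1 : (x ^ 2) ^ p ^ a = 1 := by
    rw [hr, pow_right_comm (-ζ), neg_sq, pow_right_comm (ζ ^ 2), pow_right_comm ζ,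
      hζ.pow_eq_one, one_pow, one_pow]
  have h2 : (x ^ 2) ^ m = 1 := by rw [← pow_mul, mul_comm, pow_mul, hxm, one_pow]
  have h3 := pow_gcd_eq_one.2 ⟨h1, h2⟩
  rw [(hpm.pow_left a : (p ^ a).gcd m = 1), pow_one] at h3
  exact by simpa using h3

end RootsOfUnity

namespace AffineGroup

variable {F : Type} [Field F] {φ : Fˣ →* MulAut (Multiplicative F)}

/-- The linear character of `F⁺ ⋊ Fˣ` inflated from a character of `Fˣ`. -/
def linearChar (φ : Fˣ →* MulAut (Multiplicative F)) (l : Fˣ →* ℂ) :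
    Multiplicative F ⋊[φ] Fˣ →* ℂ :=
  l.comp SemidirectProduct.rightHom

lemma linearChar_injective : Function.Injective (fun l => (linearChar φ l : _ → ℂ)) :=
  fun _ _ h => MonoidHom.ext fun u => congrFun h (SemidirectProduct.inr u)

/-- The monomial representation of `F⁺ ⋊ Fˣ` induced from the additive character `ψ`. -/
def monomialRep (hφ : ∀ (u : Fˣ) (x : F),
      φ u (Multiplicative.ofAdd x) = Multiplicative.ofAdd ((u : F) * x)) (ψ : AddChar F ℂ) :
    Representation ℂ (Multiplicative F ⋊[φ] Fˣ) (Fˣ → ℂ) where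
  toFun g :=
    { toFun := fun f y => ψ (g.left.toAdd * y) * f (g.right * y)
      map_add' := fun f f' => by ext y; simp [mul_add]
      map_smul' := fun c f => by ext y; simp; ring }
  map_one' := by ext; simp
  map_mul' g h := by
    refine LinearMap.ext fun f => funext fun y => ?_
    have : (φ g.right h.left).toAdd = g.right * h.left.toAdd := by
      rw [← ofAdd_toAdd h.left, hφ]; rfl
    simp only [LinearMap.coe_mk, AddHom.coe_mk, Module.End.mul_apply, SemidirectProduct.mul_left,
      SemidirectProduct.mul_right, toAdd_mul, this, add_mul, AddChar.map_add_eq_mul, Units.val_mul]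
    rw [mul_comm g.right h.right, mul_assoc h.right, mul_assoc (ψ _),
      mul_right_comm (g.right : F), mul_comm (_ * _) h.left.toAdd]

variable [Fintype F]

/-- The nonlinear irreducible character of `F⁺ ⋊ Fˣ`. -/
def nonlinearChar (φ : Fˣ →* MulAut (Multiplicative F)) (g : Multiplicative F ⋊[φ] Fˣ) : ℂ :=
  if g.right = 1 then if g.left = 1 then Fintype.card F - 1 else -1 else 0

lemma sum_eq [Fintype (Multiplicative F ⋊[φ] Fˣ)] (f : Multiplicative F ⋊[φ] Fˣ → ℂ) :
    ∑ g, f g = ∑ u : Fˣ, ∑ x : F, f ⟨Multiplicative.ofAdd x, u⟩ := by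
  rw [Fintype.sum_equiv (SemidirectProduct.equivProd.trans
    (Multiplicative.toAdd.prodCongr (Equiv.refl Fˣ))) f
    (fun y => f ⟨Multiplicative.ofAdd y.1, y.2⟩) (fun _ => rfl), Fintype.sum_prod_type_right]

instance : Finite (Multiplicative F ⋊[φ] Fˣ) :=
  Finite.of_equiv _ SemidirectProduct.equivProd.symm

lemma natCard_eq : (Nat.card (Multiplicative F ⋊[φ] Fˣ) : ℂ) =
    Fintype.card F * (Fintype.card F - 1) := by
  rw [SemidirectProduct.card, Nat.card_eq_fintype_card, Nat.card_eq_fintype_card,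
    Fintype.card_units, Fintype.card_multiplicative, Nat.cast_mul, Nat.cast_pred Fintype.card_pos]

lemma sum_ite_eq_zero (a b : ℂ) :
    ∑ x : F, (if x = 0 then a else b) = a + (Fintype.card F - 1) * b := by
  rw [← Finset.add_sum_erase _ _ (Finset.mem_univ (0 : F)), if_pos rfl,
    Finset.sum_congr rfl fun x hx => if_neg (Finset.ne_of_mem_erase hx)]
  simp [Finset.card_erase_of_mem, Nat.cast_pred Fintype.card_pos]

lemma sum_units (f : F → ℂ) : ∑ u : Fˣ, f u = ∑ x, f x - f 0 := by
  rw [← Finset.sum_erase_eq_sub (Finset.mem_univ 0),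
    Finset.sum_subtype (p := fun x : F => x ≠ 0) (Finset.univ.erase 0) (by simp)]
  exact Fintype.sum_equiv unitsEquivNeZero _ (fun x => f x.1) fun _ => rfl

lemma sum_mul_inv_eq [Fintype (Multiplicative F ⋊[φ] Fˣ)] {χ : Multiplicative F ⋊[φ] Fˣ → ℂ}
    {a b : ℂ} (hχ : ∀ g, χ g = if g.right = 1 then if g.left = 1 then a else b else 0) :
    ∑ g, χ g * χ g⁻¹ = a ^ 2 + (Fintype.card F - 1) * b ^ 2 := by
  have h (g) : χ g * χ g⁻¹ = if g.right = 1 then if g.left = 1 then a ^ 2 else b ^ 2 else 0 := by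
    rw [hχ, hχ]
    by_cases hr : g.right = 1
    · by_cases hl : g.left = 1 <;> simp [hr, hl, sq]
    · simp [hr]
  simp_rw [h, sum_eq]
  rw [Fintype.sum_eq_single 1 (fun u hu => by simp [hu])]
  simpa using sum_ite_eq_zero (F := F) (a ^ 2) (b ^ 2)

lemma isIrreducibleCharacter_nonlinearChar (hφ : ∀ (u : Fˣ) (x : F),
      φ u (Multiplicative.ofAdd x) = Multiplicative.ofAdd ((u : F) * x)) :
    IsIrreducibleCharacter _ (nonlinearChar φ) := by
  have := Fintype.ofFinite (Multiplicative F ⋊[φ] Fˣ)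
  obtain ⟨ψ, hψ⟩ : ∃ ψ : AddChar F ℂ, ψ ≠ 1 := by
    obtain ⟨ψ, hψ⟩ := AddChar.exists_apply_ne_zero.2 (one_ne_zero (α := F))
    exact ⟨ψ, fun h => hψ (by simp [h])⟩
  refine .of_sum_mul_inv (monomialRep hφ ψ) (fun g => ?_) ?_
  · rw [LinearMap.trace_eq_matrix_trace ℂ (Pi.basisFun ℂ Fˣ), Matrix.trace]
    have (y : Fˣ) : (LinearMap.toMatrix (Pi.basisFun ℂ Fˣ) (Pi.basisFun ℂ Fˣ)
        (monomialRep hφ ψ g)).diag y = if g.right = 1 then ψ (y * g.left.toAdd) else 0 := by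
      simp [monomialRep, Pi.single_apply, mul_comm]
    simp_rw [this, nonlinearChar]
    split_ifs with hr hl
    · simp [hl, Fintype.card_units, Nat.cast_pred Fintype.card_pos]
    · have h0 := AddChar.sum_mulShift g.left.toAdd (AddChar.IsPrimitive.of_ne_one hψ)
      rw [if_neg (by simpa using hl)] at h0
      simp [sum_units (fun x => ψ (x * g.left.toAdd)), h0]
    · simp
  · rw [sum_mul_inv_eq (χ := nonlinearChar φ) (fun _ => rfl), natCard_eq]
    ring

lemma eq_linearChar_or_eq_nonlinearChar (hφ : ∀ (u : Fˣ) (x : F),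
      φ u (Multiplicative.ofAdd x) = Multiplicative.ofAdd ((u : F) * x))
    {χ : Multiplicative F ⋊[φ] Fˣ → ℂ} (hχ : IsIrreducibleCharacter _ χ) :
    (∃ l, χ = linearChar φ l) ∨ χ = nonlinearChar φ := by
  refine or_iff_not_imp_left.2 fun hne => ?_
  push Not at hne
  have := Fintype.ofFinite (Multiplicative F ⋊[φ] Fˣ)
  have hfib (v : Fˣ) : ∑ x : F, χ ⟨Multiplicative.ofAdd x, v⟩ = 0 := by
    have h (ψ : AddChar (Additive Fˣ) ℂ) :
        ∑ u : Fˣ, ψ (Additive.ofMul (v * u⁻¹)) * ∑ x : F, χ ⟨Multiplicative.ofAdd x, u⟩ = 0 := by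
      let l : Fˣ →* ℂ := 
        { toFun := fun u => ψ (Additive.ofMul u)
          map_one' := by simp
          map_mul' := by simp [AddChar.map_add_eq_mul] }
      have := hχ.sum_mul_inv_eq_zero (.of_monoidHom (linearChar φ l)) (hne l)
      rw [sum_eq] at this
      replace this : ∑ u : Fˣ, (∑ x : F, χ ⟨Multiplicative.ofAdd x, u⟩) *
          ψ (-Additive.ofMul u) = 0 := by
        simpa [-SemidirectProduct.mk_eq_inl_mul_inr, linearChar, l, ← Finset.sum_mul] using this
      simp_rw [ofMul_mul, ofMul_inv, AddChar.map_add_eq_mul, mul_assoc, ← Finset.mul_sum,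
        mul_comm (ψ (-_)), this, mul_zero]
    have h2 : ∑ ψ : AddChar (Additive Fˣ) ℂ, ∑ u : Fˣ, ψ (Additive.ofMul (v * u⁻¹)) *
        ∑ x : F, χ ⟨Multiplicative.ofAdd x, u⟩ = 0 := Finset.sum_eq_zero fun ψ _ => h ψ
    rw [Finset.sum_comm] at h2
    simp_rw [← Finset.sum_mul, AddChar.sum_apply_eq_ite] at h2
    simpa [← ofMul_inv, ← ofMul_mul, mul_inv_eq_one, -SemidirectProduct.mk_eq_inl_mul_inr] using h2
  have hright (u : Fˣ) (hu : u ≠ 1) (x : F) : χ ⟨Multiplicative.ofAdd x, u⟩ = 0 := by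
    have hu' : (1 - u : F) ≠ 0 := sub_ne_zero.2 fun h => hu (Units.ext h.symm)
    have hc (y : F) : χ ⟨Multiplicative.ofAdd y, u⟩ = χ ⟨Multiplicative.ofAdd 0, u⟩ := by
      rw [← hχ.apply_conj ⟨Multiplicative.ofAdd 0, u⟩ ⟨Multiplicative.ofAdd (y / (1 - u)), 1⟩]
      congr 1
      ext
      · simp [hφ]
        field_simp
        ring
      · simp
    have := hfib u
    simp_rw [hc] at this
    rw [hc]
    simpa using this
  have hleft (x : F) (hx : x ≠ 0) :
      χ ⟨Multiplicative.ofAdd x, 1⟩ = χ ⟨Multiplicative.ofAdd 1, 1⟩ := by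
    rw [← hχ.apply_conj ⟨Multiplicative.ofAdd 1, 1⟩ ⟨1, Units.mk0 x hx⟩]
    congr 1
    ext
    · simp [hφ]
    · simp
  set b := χ ⟨Multiplicative.ofAdd 1, 1⟩ with hb
  have hval (g) : χ g = if g.right = 1 then if g.left = 1 then χ 1 else b else 0 := by
    obtain ⟨x, u⟩ := g
    split_ifs with hr hl
    · simp only at hr hl
      subst hr hl; rfl
    · simp only at hr hl
      subst hr
      exact hleft x.toAdd (by simpa using hl)
    · exact hright u hr x.toAdd
  obtain ⟨d, hd⟩ := hχ.apply_one
  have h1 : (d : ℂ) + (Fintype.card F - 1) * b = 0 := by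
    rw [← sum_ite_eq_zero, ← hfib 1]
    refine Finset.sum_congr rfl fun x _ => ?_
    rw [hval]
    simp [hd]
  have h2 := hχ.sum_mul_inv
  rw [sum_mul_inv_eq hval, natCard_eq, hd] at h2
  have hq : 1 < Fintype.card F := Fintype.one_lt_card
  have hq' : (Fintype.card F : ℂ) ≠ 0 := by exact_mod_cast Fintype.card_ne_zero
  have hq1 : (Fintype.card F - 1 : ℂ) ≠ 0 := sub_ne_zero.2 (by exact_mod_cast hq.ne')
  have h3 : (d : ℂ) ^ 2 = (Fintype.card F - 1) ^ 2 := by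
    refine mul_left_cancel₀ hq' ?_
    linear_combination (Fintype.card F - 1 : ℂ) * h2 +
      (d - (Fintype.card F - 1) * b : ℂ) * h1
  have h4 : (d : ℂ) = Fintype.card F - 1 := by
    refine (sq_eq_sq_iff_eq_or_eq_neg.1 h3).resolve_right fun h => ?_
    have : ((d + Fintype.card F : ℕ) : ℂ) = (1 : ℕ) := by push_cast; linear_combination h
    have := Nat.cast_injective this
    omega
  have h5 : b = -1 := mul_left_cancel₀ hq1 (by linear_combination h1 - h4)
  ext g
  rw [hval, nonlinearChar, hd, h4, h5]

lemma linearChar_ne_nonlinearChar (l : Fˣ →* ℂ) : (linearChar φ l : _ → ℂ) ≠ nonlinearChar φ := by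
  intro h
  have := congrFun h (SemidirectProduct.inl (Multiplicative.ofAdd 1))
  norm_num [linearChar, nonlinearChar] at this

variable (F) in
/-- The quadratic character of `F`, as a complex character of `Fˣ`. -/
def quadraticHom : Fˣ →* ℂ :=
  (Int.castRingHom ℂ).toMonoidHom.comp ((quadraticChar F).toMonoidHom.comp (Units.coeHom F))

lemma quadraticHom_apply (u : Fˣ) : quadraticHom F u = (quadraticChar F u : ℤ) := rfl

lemma quadraticHom_eq_one_or (u : Fˣ) : quadraticHom F u = 1 ∨ quadraticHom F u = -1 := by
  rw [quadraticHom_apply]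
  exact (quadraticChar_dichotomy u.ne_zero).imp (by simp +contextual) (by simp +contextual)

lemma quadraticHom_ne_one (hF : ringChar F ≠ 2) : quadraticHom F ≠ 1 := by
  obtain ⟨a, ha⟩ := quadraticChar_exists_neg_one' hF
  intro h
  have := DFunLike.congr_fun h a
  norm_num [quadraticHom_apply, ha] at this

lemma eq_one_or_eq_quadraticHom (hF : ringChar F ≠ 2) {l : Fˣ →* ℂ}
    (hl : ∀ u, l u = 1 ∨ l u = -1) : l = 1 ∨ l = quadraticHom F := by
  obtain ⟨g, hg⟩ := IsCyclic.exists_generator (α := Fˣ)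
  have hext {m m' : Fˣ →* ℂ} (h : m g = m' g) : m = m' := by
    ext u
    obtain ⟨k, rfl⟩ := mem_powers_iff_mem_zpowers.2 (hg u)
    simp [h]
  refine (hl g).imp (fun h => hext (by simpa using h)) fun h => hext ?_
  rw [h, (quadraticHom_eq_one_or g).resolve_left fun h' =>
    quadraticHom_ne_one hF (hext (by simpa using h'))]

lemma nonlinearChar_mem_Qfield (p : ℕ) (g : Multiplicative F ⋊[φ] Fˣ) :
    nonlinearChar φ g ∈ Qfield p := by
  rw [nonlinearChar]
  split_ifs
  · exact sub_mem (natCast_mem _ _) (one_mem _)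
  · exact neg_mem (one_mem _)
  · exact zero_mem _

end AffineGroup

/-- Let `p` be an odd prime, `n` a positive integer, `F` the finite field with
`p ^ n` elements, and `G = F⁺ ⋊ Fˣ` the semidirect product of the additive group of
`F` (written multiplicatively) by `Fˣ` acting by field multiplication.  Then `G`
has exactly three `Q_p`-valued irreducible characters. -/
theorem three_Qp_valued_irr_chars (p n : ℕ) (hp : p.Prime) (hodd : Odd p) (hn : 0 < n)
    (F : Type) [Field F] [Fintype F] (hF : Fintype.card F = p ^ n)
    (φ : Fˣ →* MulAut (Multiplicative F))
    (hφ : ∀ (u : Fˣ) (x : F),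
      φ u (Multiplicative.ofAdd x) = Multiplicative.ofAdd ((u : F) * x)) :
    (QpValuedIrrChars p (Multiplicative F ⋊[φ] Fˣ)).ncard = 3 := by
  open AffineGroup in
  have hq : 1 < Fintype.card F := Fintype.one_lt_card
  have hchar : ringChar F ≠ 2 := by
    rw [Ne, FiniteField.even_card_iff_char_two, hF, ← Nat.even_iff, Nat.not_even_iff_odd]
    exact hodd.pow
  have hcop : p.Coprime (Fintype.card F - 1) := by
    refine .coprime_dvd_left (hF ▸ dvd_pow_self p hn.ne') ?_
    exact (Nat.coprime_self_sub_right hq.le).2 (Nat.coprime_one_right _)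
  refine Set.ncard_eq_three.2 ⟨linearChar φ 1, linearChar φ (quadraticHom F), nonlinearChar φ,
    linearChar_injective.ne (quadraticHom_ne_one hchar).symm, linearChar_ne_nonlinearChar _,
    linearChar_ne_nonlinearChar _, Set.ext fun χ => ⟨fun ⟨hirr, hval⟩ => ?_, ?_⟩⟩
  · obtain ⟨l, rfl⟩ | rfl := eq_linearChar_or_eq_nonlinearChar hφ hirr
    · have hl (u : Fˣ) : l u = 1 ∨ l u = -1 := by
        refine eq_one_or_eq_neg_one_of_mem_Qfield hp hodd (Nat.sub_pos_of_lt hq) hcop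
          (hval (SemidirectProduct.inr u)) ?_
        rw [← Fintype.card_units]
        exact (map_pow l u _).symm.trans (by rw [pow_card_eq_one, map_one])
      obtain rfl | rfl := eq_one_or_eq_quadraticHom hchar hl <;> simp
    · simp
  · rintro (rfl | rfl | rfl)
    · exact ⟨.of_monoidHom _, fun g => one_mem _⟩
    · refine ⟨.of_monoidHom _, fun g => ?_⟩
      exact intCast_mem _ (quadraticChar F g.right)
    · exact ⟨isIrreducibleCharacter_nonlinearChar hφ, nonlinearChar_mem_Qfield p⟩
end
end

section
/- For every integer n ≥ 5, the number of Q_pp-valued irreducible characters of the symmetric group S_n is strictly greater than the number of conjugacy classes of S_n consisting of elements of prime power order. -/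
open scoped Classical

noncomputable section

/-- The set of `Q_pp`-valued irreducible characters of `G`: irreducible characters all
of whose values lie in `Qfield p` for some prime `p`. -/
def QppValuedIrrChars (G : Type) [Group G] : Set (G → ℂ) :=
  {χ | IsIrreducibleCharacter G χ ∧ ∃ p : ℕ, p.Prime ∧ ∀ g, χ g ∈ Qfield p}

/-- The set of conjugacy classes of `G` consisting of elements of prime power order
(the identity, of order `p ^ 0 = 1`, is included). -/
def PrimePowerClasses (G : Type) [Group G] : Set (ConjClasses G) :=
  {c | ∃ g : G, c = ConjClasses.mk g ∧ ∃ p k : ℕ, p.Prime ∧ orderOf g = p ^ k}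

theorem Equiv.Perm.cycleType_pow_of_coprime {α : Type*} [Fintype α] [DecidableEq α]
    (σ : Equiv.Perm α) {k : ℕ} (hk : k.Coprime (orderOf σ)) :
    (σ ^ k).cycleType = σ.cycleType := by
  induction σ using Equiv.Perm.cycle_induction_on with
  | base_one => simp
  | base_cycles σ hσ =>
    rw [(hσ.pow_iff.2 hk).cycleType, hσ.cycleType, Equiv.Perm.support_pow_coprime hk]
  | induction_disjoint σ τ hd hσ h₁ h₂ =>
    rw [hd.orderOf] at hk
    rw [hd.commute.mul_pow, (hd.pow_disjoint_pow k k).cycleType_mul, hd.cycleType_mul,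
      h₁ (hk.coprime_dvd_right (Nat.dvd_lcm_left _ _)),
      h₂ (hk.coprime_dvd_right (Nat.dvd_lcm_right _ _))]

/-- The spectral decomposition of an operator of finite order, at the level of traces of powers. -/
theorem LinearMap.exists_trace_pow_eq_sum {V : Type*} [AddCommGroup V] [Module ℂ V]
    [FiniteDimensional ℂ V] {n : ℕ} (hn : n ≠ 0) {ζ : ℂ} (hζ : IsPrimitiveRoot ζ n)
    (A : Module.End ℂ V) (hA : A ^ n = 1) :
    ∃ d : ℕ → ℕ, ∀ k : ℕ,
      LinearMap.trace ℂ V (A ^ k) = ∑ i ∈ Finset.range n, (d i : ℂ) * (ζ ^ i) ^ k := by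
  have hnC : (n : ℂ) ≠ 0 := Nat.cast_ne_zero.2 hn
  have hζ0 : ζ ≠ 0 := hζ.ne_zero hn
  let B : ℕ → Module.End ℂ V := fun i => (ζ ^ i)⁻¹ • A
  let e : ℕ → Module.End ℂ V := fun i => (n : ℂ)⁻¹ • ∑ j ∈ Finset.range n, B i ^ j
  have hAB (i : ℕ) : A = ζ ^ i • B i := by
    simp [B, smul_smul, hζ0]
  have hB (i : ℕ) : B i ^ n = 1 := by
    simp only [B, smul_pow, hA, inv_pow, ← pow_mul]
    rw [mul_comm, pow_mul, hζ.pow_eq_one]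
    simp
  have hBe (i : ℕ) : B i * e i = e i := by
    simp only [e, mul_smul_comm, Finset.mul_sum, ← pow_succ']
    congr 1
    have h := Finset.sum_range_succ (fun j => B i ^ j) n
    rw [Finset.sum_range_succ', hB, pow_zero] at h
    exact add_right_cancel h
  have hBke (i k : ℕ) : B i ^ k * e i = e i := by
    induction k with
    | zero => simp
    | succ k ih => rw [pow_succ, mul_assoc, hBe, ih]
  have hee (i : ℕ) : IsIdempotentElem (e i) := by
    have h : e i * e i = (n : ℂ)⁻¹ • ∑ j ∈ Finset.range n, B i ^ j * e i := by
      conv_lhs => enter [1]; simp only [e]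
      rw [smul_mul_assoc, Finset.sum_mul]
    rw [IsIdempotentElem, h]
    simp only [hBke, Finset.sum_const, Finset.card_range]
    rw [← Nat.cast_smul_eq_nsmul ℂ, smul_smul, inv_mul_cancel₀ hnC, one_smul]
  have hsum : ∑ i ∈ Finset.range n, e i = 1 := by
    have hgeom (j : ℕ) (hj : j ∈ Finset.range n) :
        ∑ i ∈ Finset.range n, ((ζ ^ i)⁻¹) ^ j = if j = 0 then (n : ℂ) else 0 := by
      split_ifs with h0
      · simp [h0]
      · have hne : (ζ⁻¹) ^ j ≠ 1 :=
          hζ.inv.pow_ne_one_of_pos_of_lt h0 (Finset.mem_range.1 hj)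
        have h1 : ((ζ⁻¹) ^ j) ^ n = 1 := by
          rw [← pow_mul, mul_comm, pow_mul, hζ.inv.pow_eq_one, one_pow]
        have h2 := mul_geom_sum ((ζ⁻¹) ^ j) n
        rw [h1, sub_self] at h2
        rw [← (mul_eq_zero.1 h2).resolve_left (sub_ne_zero.2 hne)]
        refine Finset.sum_congr rfl fun i _ => ?_
        rw [← inv_pow, ← pow_mul, ← pow_mul, mul_comm]
    simp only [e, B, smul_pow]
    rw [← Finset.smul_sum, Finset.sum_comm]
    simp only [← Finset.sum_smul]
    rw [Finset.sum_congr rfl fun j hj => by rw [hgeom j hj]]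
    simp [smul_smul, hnC, Nat.pos_of_ne_zero hn]
  refine ⟨fun i => Module.finrank ℂ (LinearMap.range (e i)), fun k => ?_⟩
  have hk : A ^ k = ∑ i ∈ Finset.range n, (ζ ^ i) ^ k • e i := by
    rw [← mul_one (A ^ k), ← hsum, Finset.mul_sum]
    refine Finset.sum_congr rfl fun i _ => ?_
    conv_lhs => rw [hAB i]
    rw [smul_pow, smul_mul_assoc, hBke]
  rw [hk, map_sum]
  refine Finset.sum_congr rfl fun i _ => ?_
  rw [map_smul, (LinearMap.IsIdempotentElem.isProj_range _ (hee i)).trace, smul_eq_mul, mul_comm]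

/-- If the trace of an operator `A` of finite order is the same as that of its powers prime to
the order, then it is rational. -/
theorem LinearMap.trace_mem_range_ratCast {V : Type*} [AddCommGroup V] [Module ℂ V]
    [FiniteDimensional ℂ V] {n : ℕ} (hn : n ≠ 0) (A : Module.End ℂ V) (hA : A ^ n = 1)
    (h : ∀ k : ℕ, k.Coprime n → LinearMap.trace ℂ V (A ^ k) = LinearMap.trace ℂ V A) :
    ∃ q : ℚ, LinearMap.trace ℂ V A = q := by
  have : NeZero n := ⟨hn⟩
  obtain ⟨K, _, _, _⟩ : ∃ (K : Type) (_ : Field K) (_ : Algebra ℚ K),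
      IsCyclotomicExtension {n} ℚ K :=
    ⟨CyclotomicField n ℚ, inferInstance, CyclotomicField.algebra n ℚ, inferInstance⟩
  have : IsGalois ℚ K := IsCyclotomicExtension.isGalois {n} ℚ K
  have : FiniteDimensional ℚ K := IsCyclotomicExtension.finiteDimensional {n} ℚ K
  have hμ : IsPrimitiveRoot (IsCyclotomicExtension.zeta n ℚ K) n :=
    IsCyclotomicExtension.zeta_spec n ℚ K
  set μ := IsCyclotomicExtension.zeta n ℚ K
  let φ : K →ₐ[ℚ] ℂ := IsAlgClosed.lift
  obtain ⟨d, hd⟩ := LinearMap.exists_trace_pow_eq_sum hn (hμ.map_of_injective φ.injective) A hA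
  let x : K := ∑ i ∈ Finset.range n, (d i : K) * μ ^ i
  have hx : φ x = LinearMap.trace ℂ V A := by
    have := hd 1
    simp only [pow_one] at this
    simp [x, this]
  have hfix : ∀ f : Gal(K/ℚ), f x = x := by
    intro f
    apply φ.toRingHom.injective
    change φ _ = φ _
    rw [hx, ← h _ (ZMod.val_coe_unit_coprime (hμ.autToPow ℚ f)), hd]
    simp only [x, map_sum, map_mul, map_natCast, map_pow]
    rw [← hμ.autToPow_spec ℚ f]
    refine Finset.sum_congr rfl fun i _ => ?_
    rw [map_pow, ← pow_mul, ← pow_mul, mul_comm i]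
    rfl
  obtain ⟨q, hq⟩ := IntermediateField.mem_bot.1 ((IsGalois.mem_bot_iff_fixed x).2 hfix)
  exact ⟨q, by rw [← hx, ← hq]; simp⟩

theorem IsIrreducibleCharacter.exists_ratCast_eq {n : ℕ} {χ : Equiv.Perm (Fin n) → ℂ}
    (hχ : IsIrreducibleCharacter (Equiv.Perm (Fin n)) χ) (g : Equiv.Perm (Fin n)) :
    ∃ q : ℚ, χ g = q := by
  obtain ⟨V, -, rfl⟩ := hχ
  refine LinearMap.trace_mem_range_ratCast (orderOf_pos g).ne' (V.ρ g)
    (by rw [← map_pow, pow_orderOf_eq_one, map_one]) fun k hk => ?_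
  obtain ⟨c, hc⟩ := isConj_iff.1
    (Equiv.Perm.isConj_iff_cycleType_eq.2 (g.cycleType_pow_of_coprime hk).symm)
  rw [← map_pow, ← hc]
  exact V.char_conj g c

variable {G : Type} [Group G]

theorem IsIrreducibleCharacter.sum_mul_inv_s14 [Fintype G] {χ ψ : G → ℂ}
    (hχ : IsIrreducibleCharacter G χ) (hψ : IsIrreducibleCharacter G ψ) :
    (Nat.card G : ℂ)⁻¹ * ∑ g, χ g * ψ g⁻¹ = if χ = ψ then 1 else 0 := by
  obtain ⟨V, hV, rfl⟩ := hχ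
  obtain ⟨W, hW, rfl⟩ := hψ
  have : Invertible (Nat.card G : ℂ) := invertibleOfNonzero (NeZero.ne _)
  split_ifs with h
  · have hVV := FDRep.char_orthonormal V V
    rw [if_pos ⟨CategoryTheory.Iso.refl V⟩] at hVV
    rw [← hVV]
    simp only [funext_iff] at h
    simp only [h]
  · have hVW := FDRep.char_orthonormal V W
    rwa [if_neg] at hVW
    rintro ⟨i⟩
    exact h (FDRep.char_iso i)

theorem finite_setOf_isIrreducibleCharacter [Finite G] :
    {χ : G → ℂ | IsIrreducibleCharacter G χ}.Finite := by
  have := Fintype.ofFinite G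
  have hli : LinearIndependent ℂ
      ((↑) : {χ : G → ℂ | IsIrreducibleCharacter G χ} → G → ℂ) := by
    rw [linearIndependent_iff']
    intro s c hc ψ hψ
    have h : ∑ χ ∈ s, c χ * ((Nat.card G : ℂ)⁻¹ * ∑ g, χ.1 g * ψ.1 g⁻¹) = 0 := by
      have h0 : (Nat.card G : ℂ)⁻¹ * ∑ g, (∑ χ ∈ s, c χ • χ.1) g * ψ.1 g⁻¹ = 0 := by
        rw [hc]; simp
      rw [← h0]
      simp only [Finset.sum_apply, Pi.smul_apply, smul_eq_mul, Finset.sum_mul, Finset.mul_sum]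
      rw [Finset.sum_comm]
      exact Finset.sum_congr rfl fun _ _ => Finset.sum_congr rfl fun _ _ => by ring
    rw [Finset.sum_congr rfl fun χ _ => by rw [χ.2.sum_mul_inv_s14 ψ.2]] at h
    simpa [Subtype.coe_inj, hψ] using h
  exact hli.set_finite_of_isNoetherian

/-- The irreducible characters separate class functions. -/
theorem eq_zero_of_sum_mul_isIrreducibleCharacter_eq_zero [Fintype G] (f : G → ℂ)
    (hf : ∀ g h : G, f (h * g * h⁻¹) = f g)
    (h0 : ∀ χ, IsIrreducibleCharacter G χ → ∑ g, f g * χ g = 0) : f = 0 := by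
  let z : MonoidAlgebra ℂ G := ∑ g, MonoidAlgebra.single g (f g)
  have hz : ∀ a, z * a = a * z := by
    intro a
    induction a using MonoidAlgebra.induction_linear with
    | zero => simp
    | add a b ha hb => rw [mul_add, add_mul, ha, hb]
    | single h c =>
      simp only [z, Finset.sum_mul, Finset.mul_sum, MonoidAlgebra.single_mul_single]
      refine Fintype.sum_equiv (MulAut.conj h⁻¹).toEquiv _ _ fun g => ?_
      simp [mul_assoc, mul_comm c, ← hf g h⁻¹]
  have : NeZero (Nat.card G : ℂ) := ⟨NeZero.ne _⟩
  have hS (S : Submodule (MonoidAlgebra ℂ G) (MonoidAlgebra ℂ G))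
      (hS : IsSimpleModule (MonoidAlgebra ℂ G) S) : ∀ x ∈ S, z * x = 0 := by
    have : FiniteDimensional ℂ S :=
      inferInstanceAs (FiniteDimensional ℂ (S.restrictScalars ℂ))
    let T : Module.End (MonoidAlgebra ℂ G) S :=
      { toFun := fun x => z • x
        map_add' := smul_add z
        map_smul' := fun a x => by simp [smul_smul, hz] }
    obtain ⟨c, hc⟩ := (IsSimpleModule.algebraMap_end_bijective_of_isAlgClosed ℂ).2 T
    let ρ : Representation ℂ G S := Representation.ofModule' S
    have hρ : ρ.IsIrreducible := by
      rw [Representation.irreducible_iff_isSimpleModule_asModule]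
      have hsmul (r : MonoidAlgebra ℂ G) (x : S) : ρ.asAlgebraHom r x = r • x := by
        simp [ρ, Representation.ofModule', Representation.asAlgebraHom]
      let E : ρ.asModule ≃ₗ[MonoidAlgebra ℂ G] S :=
        { ρ.asModuleEquiv.toAddEquiv with map_smul' := hsmul }
      exact IsSimpleModule.congr E
    have hχ : IsIrreducibleCharacter G fun g => ρ.character g := by
      refine ⟨FDRep.of ρ, ?_, rfl⟩
      have : Invertible (Nat.card G : ℂ) := invertibleOfNonzero (NeZero.ne _)
      have h := Representation.char_orthonormal ρ ρ
      rw [if_pos ⟨Representation.Equiv.refl ρ⟩, inv_mul_eq_one₀ (NeZero.ne _)] at h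
      exact (FDRep.simple_iff_char_is_norm_one _).2 h.symm
    have hT : ∑ g, f g • ρ g = c • (1 : Module.End ℂ S) := by
      ext x : 1
      have h : c • x = z • x := LinearMap.congr_fun hc x
      simp only [LinearMap.sum_apply, LinearMap.smul_apply, Module.End.one_apply, h, z,
        Finset.sum_smul]
      refine Finset.sum_congr rfl fun g _ => ?_
      change f g • (MonoidAlgebra.single g (1 : ℂ) • x) = _
      rw [← smul_assoc]
      simp
    have htr := congrArg (LinearMap.trace ℂ S) hT
    rw [map_sum, map_smul, LinearMap.trace_one] at htr
    simp only [map_smul] at htr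
    have h := (h0 _ hχ).symm.trans htr
    have := IsSimpleModule.nontrivial (MonoidAlgebra ℂ G) S
    have hc0 : c = 0 := by
      simpa [Module.finrank_pos.ne'] using h.symm
    intro x hx
    have h := LinearMap.congr_fun hc ⟨x, hx⟩
    rw [hc0, map_zero] at h
    exact (congrArg Subtype.val h).symm
  let N : Submodule (MonoidAlgebra ℂ G) (MonoidAlgebra ℂ G) :=
    { carrier := {x | z * x = 0}
      add_mem' := fun {a b} ha hb => by
        change z * (a + b) = 0
        rw [mul_add, show z * a = 0 from ha, show z * b = 0 from hb, add_zero]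
      zero_mem' := mul_zero z
      smul_mem' := fun a x hx => by
        change z * (a * x) = 0
        rw [← mul_assoc, hz, mul_assoc, show z * x = 0 from hx, mul_zero] }
  have hN : N = ⊤ := by
    rw [eq_top_iff, ← IsSemisimpleModule.sSup_simples_eq_top]
    exact sSup_le fun S h x hx => hS S h x hx
  have hz0 : z * 1 = 0 := hN.ge (Submodule.mem_top (x := 1))
  funext g
  have h := congrArg (fun a => a.coeff g) hz0
  simpa [z, Finsupp.single_apply] using h

theorem card_conjClasses_le_ncard_isIrreducibleCharacter [Finite G] :
    Nat.card (ConjClasses G) ≤ {χ : G → ℂ | IsIrreducibleCharacter G χ}.ncard := by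
  have := Fintype.ofFinite G
  have : Finite {χ : G → ℂ | IsIrreducibleCharacter G χ} := finite_setOf_isIrreducibleCharacter
  have := Fintype.ofFinite {χ : G → ℂ | IsIrreducibleCharacter G χ}
  let T : (ConjClasses G → ℂ) →ₗ[ℂ] ({χ : G → ℂ | IsIrreducibleCharacter G χ} → ℂ) :=
    { toFun := fun f χ => ∑ g, f (ConjClasses.mk g) * χ.1 g
      map_add' := fun f f' => by ext; simp [add_mul, Finset.sum_add_distrib]
      map_smul' := fun c f => by ext; simp [Finset.mul_sum, mul_assoc] }
  have hT : Function.Injective T := by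
    rw [← LinearMap.ker_eq_bot, LinearMap.ker_eq_bot']
    intro f hf
    have h := eq_zero_of_sum_mul_isIrreducibleCharacter_eq_zero (fun g => f (ConjClasses.mk g))
      (fun g h => congrArg f (ConjClasses.mk_eq_mk_iff_isConj.2 (isConj_iff.2 ⟨h, rfl⟩)).symm)
      fun χ hχ => congrFun hf ⟨χ, hχ⟩
    funext c
    obtain ⟨g, rfl⟩ := ConjClasses.exists_rep c
    exact congrFun h g
  have h := LinearMap.finrank_le_finrank_of_injective hT
  rwa [Module.finrank_pi, Module.finrank_pi, ← Nat.card_eq_fintype_card,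
    ← Nat.card_eq_fintype_card, Nat.card_coe_set_eq] at h

theorem exists_conjClasses_notMem_primePowerClasses {n : ℕ} (hn : 5 ≤ n) :
    ∃ c, c ∉ PrimePowerClasses (Equiv.Perm (Fin n)) := by
  obtain ⟨g, hg⟩ := (Equiv.Perm.exists_with_cycleType_iff (Fin n) (m := {2, 3})).2
    ⟨by simpa using hn, by simp⟩
  refine ⟨ConjClasses.mk g, ?_⟩
  rintro ⟨h, hgh, p, k, hp, hpk⟩
  have hc := Equiv.Perm.isConj_iff_cycleType_eq.1 (ConjClasses.mk_eq_mk_iff_isConj.1 hgh)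
  have h6 : p ^ k = 6 := by
    rw [← hpk, ← Equiv.Perm.lcm_cycleType, ← hc, hg]
    rfl
  have h2 := (Nat.prime_dvd_prime_iff_eq Nat.prime_two hp).1
    (Nat.prime_two.dvd_of_dvd_pow (h6 ▸ by norm_num : 2 ∣ p ^ k))
  have h3 := (Nat.prime_dvd_prime_iff_eq Nat.prime_three hp).1
    (Nat.prime_three.dvd_of_dvd_pow (h6 ▸ by norm_num : 3 ∣ p ^ k))
  omega

/-- For every `n ≥ 5`, the symmetric group `S_n` has strictly more `Q_pp`-valued
irreducible characters than conjugacy classes of elements of prime power order. -/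
theorem primePowerClasses_lt_QppValuedIrrChars_symmetricGroup (n : ℕ) (hn : 5 ≤ n) :
    (PrimePowerClasses (Equiv.Perm (Fin n))).ncard <
      (QppValuedIrrChars (Equiv.Perm (Fin n))).ncard := by
  have hQ : QppValuedIrrChars (Equiv.Perm (Fin n)) =
      {χ | IsIrreducibleCharacter (Equiv.Perm (Fin n)) χ} := by
    ext χ
    refine ⟨And.left, fun hχ => ⟨hχ, 2, Nat.prime_two, fun g => ?_⟩⟩
    obtain ⟨q, hq⟩ := hχ.exists_ratCast_eq g
    rw [hq]
    exact SubfieldClass.ratCast_mem _ q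
  obtain ⟨c, hc⟩ := exists_conjClasses_notMem_primePowerClasses hn
  rw [hQ]
  refine lt_of_lt_of_le ?_ card_conjClasses_le_ncard_isIrreducibleCharacter
  rw [← Set.ncard_univ]
  exact Set.ncard_lt_ncard (Set.ssubset_univ_iff.2 fun h => hc (h ▸ Set.mem_univ c))
end
end
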